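/- There exist a constant c > 0 and n_0 such that for every n ≥ n_0, every n-vertex (3,3)-tournament contains a directed tight path on at least c·(ln n / ln ln n)^{1/2} vertices. -/

import Mathlib

/-- An `(r,k)`-tournament on vertex set `Fin n`: every edge is an injective
`r`-tuple of vertices, and for every `r`-element set of vertices exactly `k`
of its orderings are edges. -/
def IsRKTournament (r k n : ℕ) (E : Set (Fin r → Fin n)) : Prop :=
  (∀ e ∈ E, Function.Injective e) ∧
  ∀ S : Finset (Fin n), S.card = r →
    {e | e ∈ E ∧ ∀ i, e i ∈ S}.ncard = k

/-- `v` is a directed tight path sequence in the `r`-digraph with edge set `E`: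
its entries are distinct and every `r` consecutive entries form an edge. -/
def IsTightPathSeq {r n s : ℕ} (E : Set (Fin r → Fin n)) (v : Fin s → Fin n) : Prop :=
  Function.Injective v ∧
  ∀ j : ℕ, ∀ h : j + r ≤ s,
    (fun i : Fin r => v ⟨j + i.1, by have := i.isLt; omega⟩) ∈ E

/-- The `r`-digraph with edge set `E` contains a directed tight path on `s` vertices. -/
def HasTightPath (r : ℕ) {n : ℕ} (E : Set (Fin r → Fin n)) (s : ℕ) : Prop :=
  ∃ v : Fin s → Fin n, IsTightPathSeq E v

/-- A list is tight if it is, read from its last entry to its first, a directed tight path. -/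
def IsTightList {n : ℕ} (E : Set (Fin 3 → Fin n)) (l : List (Fin n)) : Prop :=
  l.Nodup ∧ ∀ i, ∀ h : i + 2 < l.length, ![l[i + 2], l[i + 1], l[i]] ∈ E

theorem IsTightList.hasTightPath {n : ℕ} {E : Set (Fin 3 → Fin n)} {l : List (Fin n)}
    (hl : IsTightList E l) : HasTightPath 3 E l.length := by
  refine ⟨fun i => l[l.length - 1 - i.1], fun i j hij => ?_, fun j h => ?_⟩
  · have := (List.Nodup.getElem_inj_iff hl.1).mp hij
    ext
    omega
  · convert hl.2 (l.length - 3 - j) (by omega) using 1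
    funext i
    fin_cases i <;> simp <;> congr 1 <;> omega

theorem IsTightList.cons {n : ℕ} {E : Set (Fin 3 → Fin n)} {x y z : Fin n} {l : List (Fin n)}
    (hl : IsTightList E (y :: x :: l)) (hz : z ∉ y :: x :: l) (he : ![x, y, z] ∈ E) :
    IsTightList E (z :: y :: x :: l) := by
  refine ⟨List.nodup_cons.mpr ⟨hz, hl.1⟩, fun i h => ?_⟩
  cases i with
  | zero => simpa using he
  | succ i => exact hl.2 i (by simpa using h)

theorem isTightList_pair {n : ℕ} (E : Set (Fin 3 → Fin n)) {x y : Fin n} (h : x ≠ y) :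
    IsTightList E [y, x] := by
  refine ⟨by simpa using h.symm, fun i hi => ?_⟩
  simp at hi

/-- If all tight lists are short, ordered pairs can be ranked so that the rank increases along
every edge avoiding a small exceptional set of last vertices. -/
theorem exists_rank {n s : ℕ} {E : Set (Fin 3 → Fin n)}
    (hs : ∀ l, IsTightList E l → l.length < s) :
    ∃ (r : Fin n → Fin n → Fin s) (X : Fin n → Fin n → Finset (Fin n)),
      (∀ x y, (X x y).card ≤ s + 1) ∧ (∀ x y, x ∈ X x y) ∧
      ∀ x y z, x ≠ y → z ∉ X x y → ![x, y, z] ∈ E → r x y < r y z := by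
  have key : ∀ x y : Fin n, ∃ l : List (Fin n), l.length < s ∧ (x ≠ y →
      IsTightList E (y :: x :: l) ∧
        ∀ l', IsTightList E (y :: x :: l') → l'.length ≤ l.length) := by
    intro x y
    by_cases hxy : x = y
    · exact ⟨[], hs [] ⟨List.nodup_nil, fun i h => by simp at h⟩, fun h => (h hxy).elim⟩
    · let A : Set ℕ := {k | ∃ l, IsTightList E (y :: x :: l) ∧ l.length = k}
      have hA : A.Nonempty := ⟨0, [], isTightList_pair E hxy, rfl⟩
      have hb : BddAbove A := by
        refine ⟨s, ?_⟩
        rintro k ⟨l, hl, rfl⟩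
        have := hs _ hl
        simp at this
        omega
      obtain ⟨l, hl, hlen⟩ := Nat.sSup_mem hA hb
      have := hs _ hl
      simp at this
      exact ⟨l, by omega, fun _ => ⟨hl, fun l' hl' => hlen ▸ le_csSup hb ⟨l', hl', rfl⟩⟩⟩
  choose L hLs hL using key
  refine ⟨fun x y => ⟨(L x y).length, hLs x y⟩, fun x y => (y :: x :: L x y).toFinset,
    fun x y => ?_, fun x y => by simp, fun x y z hxy hz he => ?_⟩
  · refine (List.toFinset_card_le _).trans ?_
    have := hLs x y
    simp
    omega
  · rw [List.mem_toFinset] at hz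
    have hyz : y ≠ z := by
      rintro rfl
      simp at hz
    exact (hL y z hyz).2 _ ((hL x y hxy).1.cons hz he)

/-- A map assigning a small set of vertices to each ordered pair has a large free family. -/
theorem exists_free_family {V : Type*} [Fintype V] [DecidableEq V] (X : V → V → Finset V)
    (M t : ℕ) (hX : ∀ x y, (X x y).card ≤ t) (hV : M ^ 3 * t < Fintype.card V) :
    ∃ g : Fin M → V, ∀ i j k, k ≠ i → k ≠ j → g k ∉ X (g i) (g j) := by
  classical
  by_contra! H
  rcases Nat.eq_zero_or_pos M with rfl | hM
  · obtain ⟨i, -⟩ := H Fin.elim0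
    exact i.elim0
  let B : Fin M × Fin M × Fin M → Finset (Fin M → V) := fun p =>
    {g | p.2.2 ≠ p.1 ∧ p.2.2 ≠ p.2.1 ∧ g p.2.2 ∈ X (g p.1) (g p.2.1)}
  have hB : ∀ p, (B p).card ≤ t * Fintype.card V ^ (M - 1) := by
    rintro ⟨i, j, k⟩
    let f : (Fin M → V) → ({a : Fin M // a ≠ k} → V) := fun g a => g a
    have h1 := Finset.card_le_mul_card_image (f := f) (B (i, j, k)) t ?_
    · refine h1.trans (Nat.mul_le_mul_left _ ((Finset.card_le_univ _).trans ?_))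
      simp
    · intro b hb
      obtain ⟨g₀, hg₀, rfl⟩ := Finset.mem_image.mp hb
      simp only [B, Finset.mem_filter, Finset.mem_univ, true_and] at hg₀
      refine (Finset.card_le_card_of_injOn (fun g => g k) ?_ ?_).trans (hX (g₀ i) (g₀ j))
      · intro g hg
        simp only [B, Finset.coe_filter, Finset.mem_filter, Finset.mem_univ, true_and,
          Set.mem_ofPred_eq] at hg
        have hi : g i = g₀ i := congrFun hg.2 ⟨i, hg₀.1.symm⟩
        have hj : g j = g₀ j := congrFun hg.2 ⟨j, hg₀.2.1.symm⟩
        simpa [hi, hj] using hg.1.2.2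
      · intro g hg g' hg' hk
        simp only [Finset.coe_filter, Set.mem_ofPred_eq] at hg hg'
        funext a
        by_cases ha : a = k
        · rw [ha]
          exact hk
        · exact congrFun (hg.2.trans hg'.2.symm) ⟨a, ha⟩
  have hcover : (Finset.univ : Finset (Fin M → V)) ⊆ Finset.univ.biUnion B := by
    intro g _
    obtain ⟨i, j, k, h1, h2, h3⟩ := H g
    exact Finset.mem_biUnion.mpr ⟨(i, j, k), Finset.mem_univ _, by simp [B, h1, h2, h3]⟩
  have h1 := (Finset.card_le_card hcover).trans
    (Finset.card_biUnion_le_card_mul _ _ _ fun p _ => hB p)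
  simp only [Finset.card_univ, Fintype.card_pi, Finset.prod_const, Fintype.card_prod,
    Fintype.card_fin] at h1
  have hpos : 0 < Fintype.card V ^ (M - 1) := pow_pos (by omega) _
  have h2 := Nat.mul_lt_mul_of_pos_right hV hpos
  have h3 : Fintype.card V * Fintype.card V ^ (M - 1) = Fintype.card V ^ M := by
    rw [← pow_succ', Nat.sub_add_cancel hM]
  rw [h3] at h2
  refine absurd (h1.trans (le_of_eq ?_)) (not_le.mpr h2)
  ring

/-- The multicolour Ramsey theorem for triangles. -/
theorem exists_monochromatic_triangle {α κ : Type*} [LinearOrder α] [DecidableEq κ]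
    (c : α → α → κ) (K : Finset κ) (S : Finset α) (hc : ∀ i ∈ S, ∀ j ∈ S, i < j → c i j ∈ K)
    (hS : (K.card + 1).factorial < S.card) :
    ∃ i ∈ S, ∃ j ∈ S, ∃ k ∈ S, i < j ∧ j < k ∧ c i j = c j k ∧ c i k = c j k := by
  induction hq : K.card generalizing K S with
  | zero =>
    rw [hq] at hS
    obtain ⟨i, hi, j, hj, hij⟩ := Finset.one_lt_card.mp (by simpa using hS)
    rw [Finset.card_eq_zero] at hq
    rcases lt_or_gt_of_ne hij with h | h
    · simpa [hq] using hc i hi j hj h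
    · simpa [hq] using hc j hj i hi h
  | succ q ih =>
    rw [hq] at hS
    have hne : S.Nonempty := Finset.card_pos.mp (by omega)
    set x := S.min' hne
    have hx : x ∈ S := S.min'_mem hne
    have hlt : ∀ y ∈ S.erase x, x < y := fun y hy => S.min'_lt_of_mem_erase_min' hne hy
    have hcard : K.card * (q + 1).factorial < (S.erase x).card := by
      rw [Finset.card_erase_of_mem hx, hq]
      have h1 := Nat.factorial_succ (q + 1)
      have h2 := Nat.factorial_pos (q + 1)
      have h3 : (q + 1 + 1) * (q + 1).factorial =
        (q + 1) * (q + 1).factorial + (q + 1).factorial := by ring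
      omega
    obtain ⟨a, ha, hlarge⟩ := Finset.exists_lt_card_fiber_of_mul_lt_card_of_maps_to
      (fun y hy => hc x hx y (Finset.mem_of_mem_erase hy) (hlt y hy)) hcard
    set S' := {y ∈ S.erase x | c x y = a}
    have hS' : ∀ y ∈ S', y ∈ S ∧ x < y ∧ c x y = a := fun y hy => by
      obtain ⟨h1, h2⟩ := Finset.mem_filter.mp hy
      exact ⟨Finset.mem_of_mem_erase h1, hlt y h1, h2⟩
    by_cases h : ∃ i ∈ S', ∃ j ∈ S', i < j ∧ c i j = a
    · obtain ⟨i, hi, j, hj, hij, hca⟩ := h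
      obtain ⟨hi1, hi2, hi3⟩ := hS' i hi
      obtain ⟨hj1, hj2, hj3⟩ := hS' j hj
      exact ⟨x, hx, i, hi1, j, hj1, hi2, hij, hi3.trans hca.symm, hj3.trans hca.symm⟩
    · push Not at h
      have hK : (K.erase a).card = q := by
        rw [Finset.card_erase_of_mem ha, hq, Nat.add_sub_cancel]
      obtain ⟨i, hi, j, hj, k, hk, hijk⟩ := ih (K.erase a) S'
        (fun i hi j hj hij => Finset.mem_erase.mpr
          ⟨h i hi j hj hij, hc i (hS' i hi).1 j (hS' j hj).1 hij⟩) (by rwa [hK]) hK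
      exact ⟨i, (hS' i hi).1, j, (hS' j hj).1, k, (hS' k hk).1, hijk⟩

/-- A rank on ordered pairs that increases along all edges inside a triple cannot be constant on
the forward pairs and on the backward pairs of the triple. -/
theorem IsRKTournament.not_monochromatic {n : ℕ} {E : Set (Fin 3 → Fin n)}
    (hE : IsRKTournament 3 3 n E) {κ : Type*} [LinearOrder κ] {r : Fin n → Fin n → κ}
    {a b c : Fin n} (hab : a ≠ b) (hac : a ≠ c) (hbc : b ≠ c)
    (hr : ∀ e ∈ E, (∀ i, e i ∈ ({a, b, c} : Finset (Fin n))) → r (e 0) (e 1) < r (e 1) (e 2))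
    (h1 : r a b = r b c) (h2 : r a c = r b c) (h3 : r b a = r c b) (h4 : r c a = r c b) :
    False := by
  have hcard := hE.2 {a, b, c} (Finset.card_eq_three.mpr ⟨a, b, c, hab, hac, hbc, rfl⟩)
  have hform : ∀ e ∈ E, (∀ i, e i ∈ ({a, b, c} : Finset (Fin n))) →
      (r b c < r c b ∧ (e = ![a, c, b] ∨ e = ![b, c, a])) ∨
      (r c b < r b c ∧ (e = ![b, a, c] ∨ e = ![c, a, b])) := by
    intro e he hmem
    have hlt := hr e he hmem
    have hinj := hE.1 e he
    have h01 : e 0 ≠ e 1 := hinj.ne (by decide)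
    have h02 : e 0 ≠ e 2 := hinj.ne (by decide)
    have h12 : e 1 ≠ e 2 := hinj.ne (by decide)
    have heq : e = ![e 0, e 1, e 2] := by
      funext i
      fin_cases i <;> rfl
    have m0 := hmem 0
    have m1 := hmem 1
    have m2 := hmem 2
    simp only [Finset.mem_insert, Finset.mem_singleton] at m0 m1 m2
    rw [heq]
    rcases m0 with m0 | m0 | m0 <;> rcases m1 with m1 | m1 | m1 <;>
      rcases m2 with m2 | m2 | m2 <;>
      first
      | exact absurd (m0.trans m1.symm) h01
      | exact absurd (m0.trans m2.symm) h02
      | exact absurd (m1.trans m2.symm) h12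
      | (rw [m0, m1, m2] at hlt
         rw [m0, m1, m2]
         first
         | exact Or.inl ⟨by order, Or.inl rfl⟩
         | exact Or.inl ⟨by order, Or.inr rfl⟩
         | exact Or.inr ⟨by order, Or.inl rfl⟩
         | exact Or.inr ⟨by order, Or.inr rfl⟩
         | (exfalso; order))
  have hsub : ∃ u v, {e | e ∈ E ∧ ∀ i, e i ∈ ({a, b, c} : Finset (Fin n))} ⊆ {u, v} := by
    rcases le_total (r b c) (r c b) with h | h
    · refine ⟨![a, c, b], ![b, c, a], fun e he => ?_⟩
      exact (hform e he.1 he.2).elim And.right fun h' => absurd h'.1 h.not_gt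
    · refine ⟨![b, a, c], ![c, a, b], fun e he => ?_⟩
      exact (hform e he.1 he.2).elim (fun h' => absurd h'.1 h.not_gt) And.right
  obtain ⟨u, v, huv⟩ := hsub
  have h5 := Set.ncard_le_ncard huv
  have h6 := Set.ncard_insert_le u {v}
  rw [Set.ncard_singleton] at h6
  omega

theorem exists_long_isTightList {n s : ℕ} {E : Set (Fin 3 → Fin n)}
    (hE : IsRKTournament 3 3 n E) (hn : ((s * s + 1).factorial + 1) ^ 3 * (s + 1) < n)
    (hs : ∀ l, IsTightList E l → l.length < s) : False := by
  obtain ⟨r, X, hX, hXmem, hr⟩ := exists_rank hs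
  obtain ⟨g, hg⟩ := exists_free_family X _ _ hX (by simpa using hn)
  have hinj : Function.Injective g := by
    intro i j hij
    by_contra hne
    exact hg i i j (Ne.symm hne) (Ne.symm hne) (hij ▸ hXmem (g i) (g i))
  obtain ⟨i, -, j, -, k, -, hij, hjk, e1, e2⟩ := exists_monochromatic_triangle
    (fun i j => (r (g i) (g j), r (g j) (g i))) Finset.univ Finset.univ
    (fun _ _ _ _ _ => Finset.mem_univ _) (by simp)
  simp only [Prod.mk.injEq] at e1 e2
  refine hE.not_monochromatic (hinj.ne hij.ne) (hinj.ne (hij.trans hjk).ne) (hinj.ne hjk.ne)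
    (r := r) (fun e he hmem => ?_) e1.1 e2.1 e1.2 e2.2
  have hmem' : ∀ a, ∃ p, g p = e a := by
    intro a
    have := hmem a
    simp only [Finset.mem_insert, Finset.mem_singleton] at this
    rcases this with h | h | h <;> exact ⟨_, h.symm⟩
  choose p hp using hmem'
  have heinj := hE.1 e he
  have hpne : ∀ a b, a ≠ b → p a ≠ p b := by
    intro a b hab h
    exact hab (heinj (by rw [← hp a, ← hp b, h]))
  refine hr _ _ _ (heinj.ne (by decide)) ?_ ?_
  · rw [← hp 0, ← hp 1, ← hp 2]
    exact hg _ _ _ (hpne _ _ (by decide)) (hpne _ _ (by decide))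
  · convert he using 1
    funext a
    fin_cases a <;> rfl

theorem factorial_bound {s : ℕ} (hs : 2 ≤ s) :
    ((s * s + 1).factorial + 1) ^ 3 * (s + 1) ≤ s ^ (19 * s ^ 2) := by
  have h1 : (s * s + 1).factorial + 1 ≤ s ^ (6 * s ^ 2) := by
    calc (s * s + 1).factorial + 1 ≤ (s * s + 2).factorial :=
          Nat.succ_le_of_lt ((Nat.factorial_lt (by omega)).mpr (by omega))
      _ ≤ (s * s + 2) ^ (s * s + 2) := Nat.factorial_le_pow _
      _ ≤ (s ^ 3) ^ (s * s + 2) := Nat.pow_le_pow_left (by nlinarith) _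
      _ ≤ (s ^ 3) ^ (2 * s ^ 2) := Nat.pow_le_pow_right (by positivity) (by nlinarith)
      _ = s ^ (6 * s ^ 2) := by rw [← pow_mul]; ring_nf
  have h2 : s + 1 ≤ s ^ s ^ 2 :=
    calc s + 1 ≤ s ^ 2 := by nlinarith
      _ ≤ s ^ s ^ 2 := Nat.pow_le_pow_right (by omega) (by nlinarith)
  calc _ ≤ (s ^ (6 * s ^ 2)) ^ 3 * s ^ s ^ 2 := Nat.mul_le_mul (Nat.pow_le_pow_left h1 3) h2
    _ = s ^ (19 * s ^ 2) := by rw [← pow_mul, ← pow_add]; ring_nf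

theorem exists_size_bound (n : ℕ) (hn : Real.exp 40000 ≤ n) :
    ∃ s : ℕ, 1 / 10 * Real.sqrt (Real.log n / Real.log (Real.log n)) ≤ s ∧
      ((s * s + 1).factorial + 1) ^ 3 * (s + 1) < n := by
  have hn0 : (0 : ℝ) < n := (Real.exp_pos _).trans_le hn
  have hL : 40000 ≤ Real.log n := (Real.le_log_iff_exp_le hn0).mpr hn
  set L := Real.log n
  have hL0 : 0 < L := by linarith
  have hLL : 1 ≤ Real.log L := by
    rw [Real.le_log_iff_exp_le hL0]
    linarith [Real.exp_one_lt_d9]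
  have hsq : Real.sqrt L ^ 2 = L := Real.sq_sqrt hL0.le
  have hsL : 200 ≤ Real.sqrt L := Real.le_sqrt_of_sq_le (by linarith)
  have hlog : Real.log L = 2 * Real.log (Real.sqrt L) := by
    rw [Real.log_sqrt hL0.le]
    ring
  have hLL2 : 100 * Real.log L ≤ L := by
    have := Real.log_le_self (Real.sqrt_nonneg L)
    nlinarith
  set Y := Real.sqrt (L / Real.log L) with hY
  have hYsq : Y ^ 2 = L / Real.log L := Real.sq_sqrt (by positivity)
  have hY10 : 10 ≤ Y := Real.le_sqrt_of_sq_le (by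
    rw [le_div_iff₀ (by linarith)]
    linarith)
  have hYL : Y ≤ Real.sqrt L := Real.sqrt_le_sqrt (div_le_self hL0.le hLL)
  refine ⟨⌈1 / 10 * Y⌉₊ + 1, ?_, ?_⟩
  · push_cast
    linarith [Nat.le_ceil (1 / 10 * Y)]
  · have hc1 : 1 ≤ ⌈1 / 10 * Y⌉₊ := Nat.one_le_ceil_iff.mpr (by linarith)
    have hc2 : (⌈1 / 10 * Y⌉₊ : ℝ) < 1 / 10 * Y + 1 := Nat.ceil_lt_add_one (by linarith)
    obtain ⟨s, hs⟩ : ∃ s, s = ⌈1 / 10 * Y⌉₊ + 1 := ⟨_, rfl⟩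
    rw [← hs]
    have hs2 : 2 ≤ s := by omega
    have hs3 : (s : ℝ) ≤ 3 / 10 * Y := by
      rw [hs]
      push_cast
      linarith
    refine (factorial_bound hs2).trans_lt ?_
    have hs0 : (0 : ℝ) < s := by positivity
    have hlogs : Real.log s ≤ Real.log L / 2 := by
      rw [hlog]
      have := Real.log_le_log hs0 (show (s : ℝ) ≤ Real.sqrt L by linarith)
      linarith
    have hssq : (s : ℝ) ^ 2 * Real.log L ≤ 9 / 100 * L := by
      have : (s : ℝ) ^ 2 ≤ 9 / 100 * (L / Real.log L) := by
        rw [← hYsq]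
        nlinarith
      calc _ ≤ 9 / 100 * (L / Real.log L) * Real.log L := by gcongr
        _ = 9 / 100 * L := by field_simp
    have hfin : Real.log ((s : ℝ) ^ (19 * s ^ 2)) < L := by
      rw [Real.log_pow]
      push_cast
      have := mul_le_mul_of_nonneg_left hlogs (sq_nonneg (s : ℝ))
      linarith
    exact_mod_cast (Real.log_lt_log_iff (by positivity) hn0).mp hfin

/-- Theorem: there is `c > 0` such that every sufficiently large `n`-vertex
`(3,3)`-tournament contains a tight path on at least
`c·(ln n / ln ln n)^{1/2}` vertices. -/
theorem stmt19 :
    ∃ c : ℝ, 0 < c ∧ ∃ n₀ : ℕ, ∀ n : ℕ, n₀ ≤ n →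
      ∀ E : Set (Fin 3 → Fin n), IsRKTournament 3 3 n E →
        ∃ s : ℕ, c * Real.sqrt (Real.log n / Real.log (Real.log n)) ≤ (s : ℝ) ∧
          HasTightPath 3 E s := by
  refine ⟨1 / 10, by norm_num, ⌈Real.exp 40000⌉₊, fun n hn E hE => ?_⟩
  obtain ⟨s, hs, hsn⟩ := exists_size_bound n (Nat.ceil_le.mp hn)
  by_contra! H
  refine exists_long_isTightList hE hsn fun l hl => ?_
  by_contra! h_len
  exact H l.length (hs.trans (by exact_mod_cast h_len)) hl.hasTightPath
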